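/- The set of nonzero nilpotent complex hypermatrices in Vᶜ (those nonzero T ∈ Vᶜ such that 0 lies in the closure of the Gᶜ-orbit of T) is a union of Gᶜ-orbits, and it decomposes into exactly 30 distinct Gᶜ-orbits. -/

import Mathlib

/-- The space of complex 2×2×2×2 hypermatrices. -/
abbrev V : Type := Fin 2 → Fin 2 → Fin 2 → Fin 2 → ℂ

/-- The group `SL₂(ℂ)⁴`. -/
abbrev G : Type :=
  Matrix.SpecialLinearGroup (Fin 2) ℂ × Matrix.SpecialLinearGroup (Fin 2) ℂ ×
    Matrix.SpecialLinearGroup (Fin 2) ℂ × Matrix.SpecialLinearGroup (Fin 2) ℂ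

/-- The natural linear action of `G = SL₂(ℂ)⁴` on `V`. -/
noncomputable def actG (g : G) (T : V) : V := fun i₁ i₂ i₃ i₄ =>
  ∑ j₁ : Fin 2, ∑ j₂ : Fin 2, ∑ j₃ : Fin 2, ∑ j₄ : Fin 2,
    (g.1 : Matrix (Fin 2) (Fin 2) ℂ) i₁ j₁ * (g.2.1 : Matrix (Fin 2) (Fin 2) ℂ) i₂ j₂ *
      (g.2.2.1 : Matrix (Fin 2) (Fin 2) ℂ) i₃ j₃ * (g.2.2.2 : Matrix (Fin 2) (Fin 2) ℂ) i₄ j₄ *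
      T j₁ j₂ j₃ j₄

/-- The `G`-orbit of a hypermatrix. -/
def orbitG (T : V) : Set V := {S | ∃ g : G, actG g T = S}

namespace Hypermatrix

/-- A multi-index of a `2×2×2×2` hypermatrix. -/
abbrev Word : Type := Fin 4 → Fin 2

/-- Hypermatrices in uncurried form, convenient for permuting the four factors. -/
abbrev Tensor : Type := Word → ℂ

theorem sum_word {M : Type*} [AddCommMonoid M] (f : Word → M) :
    ∑ w, f w = ∑ a, ∑ b, ∑ c, ∑ d, f ![a, b, c, d] := by
  let e : Fin 2 × Fin 2 × Fin 2 × Fin 2 ≃ Word :=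
    { toFun := fun x => ![x.1, x.2.1, x.2.2.1, x.2.2.2]
      invFun := fun w => (w 0, w 1, w 2, w 3)
      left_inv := fun x => rfl
      right_inv := fun w => by ext i; fin_cases i <;> rfl }
  rw [← Equiv.sum_comp e]
  simp only [Fintype.sum_prod_type]
  rfl

theorem exists_word (w : Word) : ∃ a b c d, w = ![a, b, c, d] :=
  ⟨w 0, w 1, w 2, w 3, by ext i; fin_cases i <;> rfl⟩

/-- The action of four matrices on a tensor, one on each factor. -/
def act (g : Fin 4 → Matrix (Fin 2) (Fin 2) ℂ) (T : Tensor) : Tensor :=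
  fun w => ∑ v, (∏ s, g s (w s) (v s)) * T v

theorem act_act (g h : Fin 4 → Matrix (Fin 2) (Fin 2) ℂ) (T : Tensor) :
    act g (act h T) = act (g * h) T := by
  funext w
  simp only [act, Pi.mul_apply, Matrix.mul_apply, Finset.prod_univ_sum, Fintype.piFinset_univ,
    Finset.mul_sum, Finset.sum_mul, Finset.prod_mul_distrib]
  rw [Finset.sum_comm]
  exact Finset.sum_congr rfl fun _ _ => Finset.sum_congr rfl fun _ _ => (mul_assoc _ _ _).symm

theorem act_diagonal (d : Fin 4 → Fin 2 → ℂ) (T : Tensor) :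
    act (fun s => Matrix.diagonal (d s)) T = fun w => (∏ s, d s (w s)) * T w := by
  funext w
  rw [act, Finset.sum_eq_single w]
  · simp
  · intro v _ hv
    obtain ⟨s, hs⟩ := Function.ne_iff.1 hv
    rw [Finset.prod_eq_zero (Finset.mem_univ s), zero_mul]
    exact Matrix.diagonal_apply_ne _ hs.symm
  · simp

theorem act_one (T : Tensor) : act 1 T = T := by
  have := act_diagonal (fun _ _ => 1) T
  simpa [← Pi.one_def] using this

theorem act_update (s : Fin 4) (M : Matrix (Fin 2) (Fin 2) ℂ) (T : Tensor) :
    act (Function.update 1 s M) T =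
      fun w => ∑ a, M (w s) a * T (Function.update w s a) := by
  funext w
  have hinj : Function.Injective fun a => Function.update w s a := Function.update_injective w s
  rw [act, ← Finset.sum_subset
      (Finset.subset_univ (Finset.univ.image fun a => Function.update w s a)),
    Finset.sum_image hinj.injOn]
  · refine Finset.sum_congr rfl fun a _ => ?_
    congr 1
    rw [Finset.prod_eq_single s]
    · simp
    · intro r _ hr
      simp [hr]
    · simp
  · intro v _ hv
    obtain ⟨r, hr, hne⟩ : ∃ r, r ≠ s ∧ w r ≠ v r := by
      by_contra! h
      refine hv (Finset.mem_image.2 ⟨v s, Finset.mem_univ _, ?_⟩)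
      funext r
      by_cases hr : r = s
      · subst hr; simp
      · simp [hr, h r hr]
    rw [Finset.prod_eq_zero (Finset.mem_univ r), zero_mul]
    simp [hr, hne]

/-- Permutation of the factors of a tensor. -/
def permute (σ : Equiv.Perm (Fin 4)) (T : Tensor) : Tensor := fun w => T (w ∘ σ)

theorem act_permute (g : Fin 4 → Matrix (Fin 2) (Fin 2) ℂ) (σ : Equiv.Perm (Fin 4))
    (T : Tensor) : act g (permute σ T) = permute σ (act (g ∘ σ) T) := by
  funext w
  simp only [act, permute]
  refine Fintype.sum_equiv (Equiv.arrowCongr σ.symm (Equiv.refl _)) _ _ fun v => ?_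
  have : (Equiv.arrowCongr σ.symm (Equiv.refl (Fin 2))) v = v ∘ σ := by
    funext i; simp
  rw [this]
  congr 1
  exact (Equiv.prod_comp σ fun s => g s (w s) (v s)).symm

theorem permute_permute (σ τ : Equiv.Perm (Fin 4)) (T : Tensor) :
    permute σ (permute τ T) = permute (σ * τ) T := rfl

theorem permute_one (T : Tensor) : permute 1 T = T := rfl

/-- Two tensors are related if they lie in the same orbit of `SL₂(ℂ)⁴`. -/
def Rel (T S : Tensor) : Prop :=
  ∃ g : Fin 4 → Matrix.SpecialLinearGroup (Fin 2) ℂ, act (fun s => (g s).1) T = S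

theorem Rel.refl (T : Tensor) : Rel T T := ⟨1, act_one T⟩

theorem Rel.trans {T S R : Tensor} (h₁ : Rel T S) (h₂ : Rel S R) : Rel T R := by
  obtain ⟨g, rfl⟩ := h₁
  obtain ⟨h, rfl⟩ := h₂
  exact ⟨h * g, by rw [act_act]; rfl⟩

theorem Rel.symm {T S : Tensor} (h : Rel T S) : Rel S T := by
  obtain ⟨g, rfl⟩ := h
  refine ⟨g⁻¹, ?_⟩
  rw [act_act]
  convert act_one T using 2
  funext s
  exact congrArg Subtype.val (inv_mul_cancel (g s))

theorem Rel.permute {T S : Tensor} (σ : Equiv.Perm (Fin 4)) (h : Rel T S) :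
    Rel (permute σ T) (permute σ S) := by
  obtain ⟨g, rfl⟩ := h
  refine ⟨g ∘ σ.symm, ?_⟩
  rw [act_permute]
  congr 2
  funext s
  simp

theorem rel_update (s : Fin 4) (M : Matrix (Fin 2) (Fin 2) ℂ) (hM : M.det = 1) (T : Tensor) :
    Rel T (fun w => ∑ a, M (w s) a * T (Function.update w s a)) := by
  obtain ⟨m, rfl⟩ : ∃ m : Matrix.SpecialLinearGroup (Fin 2) ℂ, m.1 = M := ⟨⟨M, hM⟩, rfl⟩
  refine ⟨Function.update 1 s m, ?_⟩
  rw [← act_update]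
  congr 1
  funext r
  by_cases h : r = s
  · subst h
    rw [Function.update_self, Function.update_self]
  · rw [Function.update_of_ne h, Function.update_of_ne h]
    rfl

theorem Rel.ne_zero {T S : Tensor} (h : Rel T S) (hT : T ≠ 0) : S ≠ 0 := by
  rintro rfl
  obtain ⟨g, hg⟩ := h.symm
  apply hT
  rw [← hg]
  funext w
  simp [act]

theorem continuous_act (T : Tensor) : Continuous fun g => act g T := by
  unfold act
  fun_prop

/-- The word obtained by moving every letter by the corresponding letter of `f`. -/
def flipWord (f w : Word) : Word := f + w

theorem flipWord_flipWord (f w : Word) : flipWord f (flipWord f w) = w := by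
  funext s
  simp only [flipWord, Pi.add_apply]
  generalize f s = a
  generalize w s = b
  revert a b
  decide

/-- Exchanging basis vectors (up to sign) in some of the factors. -/
theorem exists_rel_flip (f : Word) (T : Tensor) :
    ∃ S, Rel T S ∧ ∀ w, S w ≠ 0 ↔ T (flipWord f w) ≠ 0 := by
  let J : Fin 2 → Matrix (Fin 2) (Fin 2) ℂ := ![1, !![0, 1; -1, 0]]
  have hJ : ∀ a, (J a).det = 1 := by
    intro a
    fin_cases a <;> simp [J, Matrix.det_fin_two]
  refine ⟨_, ⟨fun s => ⟨J (f s), hJ _⟩, rfl⟩, fun w => ?_⟩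
  have h0 : ∀ a b c : Fin 2, J a b c ≠ 0 ↔ c = a + b := by
    intro a b c
    fin_cases a <;> fin_cases b <;> fin_cases c <;> simp [J]
  rw [act, Finset.sum_eq_single (flipWord f w)]
  · have : ∏ s, J (f s) (w s) (flipWord f w s) ≠ 0 :=
      Finset.prod_ne_zero_iff.2 fun s _ => (h0 _ _ _).2 rfl
    simp [this]
  · intro v _ hv
    obtain ⟨s, hs⟩ := Function.ne_iff.1 hv
    rw [Finset.prod_eq_zero (Finset.mem_univ s), zero_mul]
    by_contra h
    exact hs ((h0 _ _ _).1 h)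
  · simp

/-- The sign by which the diagonal torus acts on a basis vector. -/
def sgn (a : Fin 2) : ℤ := ![1, -1] a

/-- The indicator tensor of a set of words. -/
def ind (S : Finset Word) : Tensor := fun w => if w ∈ S then 1 else 0

/-- A set of words is good if the torus rescales every tensor with that support to the
indicator. -/
def Good (S : Finset Word) : Prop := ∀ T : Tensor, (∀ w, T w ≠ 0 ↔ w ∈ S) → Rel T (ind S)

theorem rel_torus (x : Fin 4 → ℂ) (T : Tensor) :
    Rel T (fun w => Complex.exp (∑ s, sgn (w s) * x s) * T w) := by
  refine ⟨fun s => ⟨Matrix.diagonal fun a => Complex.exp (sgn a * x s), ?_⟩, ?_⟩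
  · simp [sgn, Matrix.det_diagonal, ← Complex.exp_add]
  · simp only [act_diagonal, Complex.exp_sum]

theorem good_of_det (q : Fin 4 → Word) (hq : (Matrix.of fun i s => sgn (q i s)).det ≠ 0)
    (S : Finset Word) (hS : S ⊆ Finset.univ.image q) : Good S := by
  intro T hT
  set M : Matrix (Fin 4) (Fin 4) ℂ :=
    (Matrix.of fun i s => sgn (q i s)).map (Int.castRingHom ℂ) with hM
  have hdet : IsUnit M.det := by
    rw [isUnit_iff_ne_zero, hM, ← RingHom.mapMatrix_apply, ← RingHom.map_det]
    simpa using hq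
  set b : Fin 4 → ℂ := fun i => -Complex.log (T (q i))
  have hx : M.mulVec (M⁻¹.mulVec b) = b := by
    rw [Matrix.mulVec_mulVec, Matrix.mul_nonsing_inv _ hdet, Matrix.one_mulVec]
  refine (rel_torus (M⁻¹.mulVec b) T).trans ?_
  convert Rel.refl (ind S) using 1
  funext w
  by_cases hw : w ∈ S
  · obtain ⟨i, -, rfl⟩ := Finset.mem_image.1 (hS hw)
    have hi := congrFun hx i
    have hTi := (hT _).2 hw
    have : ∑ s, (sgn (q i s) : ℂ) * (M⁻¹.mulVec b) s = b i := by
      rw [← hi]; rfl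
    rw [this]
    simp [b, ind, hw, Complex.exp_neg, Complex.exp_log hTi, hTi]
  · have : T w = 0 := by
      by_contra h
      exact hw ((hT w).1 h)
    simp [ind, hw, this]

theorem norm_act_le (g : Fin 4 → Matrix (Fin 2) (Fin 2) ℂ) (hg : ∀ s i j, ‖g s i j‖ ≤ 1)
    (T : Tensor) : ‖act g T‖ ≤ 16 * ‖T‖ := by
  refine (pi_norm_le_iff_of_nonneg (by positivity)).2 fun w => ?_
  calc ‖act g T w‖ ≤ ∑ v : Word, ‖(∏ s, g s (w s) (v s)) * T v‖ := norm_sum_le _ _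
    _ ≤ ∑ _v : Word, ‖T‖ := by
        refine Finset.sum_le_sum fun v _ => ?_
        rw [norm_mul, norm_prod]
        have : ∏ s, ‖g s (w s) (v s)‖ ≤ 1 :=
          Finset.prod_le_one (fun _ _ => norm_nonneg _) fun s _ => hg s _ _
        exact (mul_le_of_le_one_left (norm_nonneg _) this).trans (norm_le_pi_norm T v)
    _ = 16 * ‖T‖ := by simp

/-- The special unitary matrix with first row `(a, b)`. -/
def su (a b : ℂ) : Matrix (Fin 2) (Fin 2) ℂ := !![a, b; -star b, star a]

/-- The special unitary matrices of size two. -/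
def SU : Set (Matrix (Fin 2) (Fin 2) ℂ) :=
  {k | ∃ a b : ℂ, ‖a‖ ^ 2 + ‖b‖ ^ 2 = 1 ∧ k = su a b}

theorem isCompact_SU : IsCompact SU := by
  have hc : IsCompact {x : ℂ × ℂ | ‖x.1‖ ^ 2 + ‖x.2‖ ^ 2 = 1} := by
    refine Metric.isCompact_of_isClosed_isBounded
      (isClosed_eq (by fun_prop) continuous_const) ?_
    refine (Metric.isBounded_closedBall (x := (0 : ℂ × ℂ)) (r := 1)).subset fun x hx => ?_
    rw [mem_closedBall_zero_iff, Prod.norm_def, sup_le_iff]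
    have hx' : ‖x.1‖ ^ 2 + ‖x.2‖ ^ 2 = 1 := hx
    constructor <;> nlinarith [sq_nonneg ‖x.1‖, sq_nonneg ‖x.2‖, norm_nonneg x.1, norm_nonneg x.2]
  have hf : Continuous fun x : ℂ × ℂ => su x.1 x.2 := by
    unfold su
    refine continuous_matrix fun i j => ?_
    fin_cases i <;> fin_cases j <;> simp <;> fun_prop
  convert hc.image hf using 1
  ext k
  simp only [SU, Set.mem_ofPred_eq, Set.mem_image, Prod.exists]
  constructor
  · rintro ⟨a, b, h, rfl⟩; exact ⟨a, b, h, rfl⟩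
  · rintro ⟨a, b, h, rfl⟩; exact ⟨a, b, h, rfl⟩

theorem det_of_mem_SU {k : Matrix (Fin 2) (Fin 2) ℂ} (hk : k ∈ SU) : k.det = 1 := by
  obtain ⟨a, b, h, rfl⟩ := hk
  have h' : a * star a + b * star b = 1 := by
    simp only [Complex.star_def, Complex.mul_conj, Complex.normSq_eq_norm_sq]
    exact_mod_cast h
  rw [su, Matrix.det_fin_two_of]
  linear_combination h'

theorem exists_mulVec_eq_smul (H : Matrix (Fin 2) (Fin 2) ℂ) :
    ∃ (μ : ℂ) (v : Fin 2 → ℂ), v ≠ 0 ∧ H.mulVec v = μ • v := by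
  obtain ⟨μ, hμ⟩ := Module.End.exists_eigenvalue (Matrix.toLin' H)
  obtain ⟨v, hv⟩ := hμ.exists_hasEigenvector
  exact ⟨μ, v, hv.2, by simpa using hv.apply_eq_smul⟩

/-- A weak form of the singular value decomposition: up to a matrix on the left with bounded
inverse, every unimodular matrix is a positive diagonal one times a special unitary one. -/
theorem exists_decomposition (g : Matrix (Fin 2) (Fin 2) ℂ) (hg : g.det = 1) :
    ∃ (u k : Matrix (Fin 2) (Fin 2) ℂ) (x : ℝ), (∀ i j, ‖u i j‖ ≤ 1) ∧ k ∈ SU ∧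
      u * g = Matrix.diagonal (fun a => (Real.exp (sgn a * x) : ℂ)) * k := by
  obtain ⟨μ, v, hv, hμ⟩ := exists_mulVec_eq_smul (g.conjTranspose * g)
  obtain ⟨a, b, hab, hμ1, hμ2⟩ : ∃ a b : ℂ, ‖a‖ ^ 2 + ‖b‖ ^ 2 = 1 ∧
      (g.conjTranspose * g).mulVec ![a, b] 0 = μ * a ∧
      (g.conjTranspose * g).mulVec ![a, b] 1 = μ * b := by
    set n : ℝ := Real.sqrt (‖v 0‖ ^ 2 + ‖v 1‖ ^ 2)
    have hpos : 0 < ‖v 0‖ ^ 2 + ‖v 1‖ ^ 2 := by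
      rcases Fin.exists_fin_two.1 (Function.ne_iff.1 hv) with h | h
      · have := norm_pos_iff.2 h
        positivity
      · have := norm_pos_iff.2 h
        positivity
    have hn : 0 < n := Real.sqrt_pos.2 hpos
    have hn2 : n ^ 2 = ‖v 0‖ ^ 2 + ‖v 1‖ ^ 2 := Real.sq_sqrt hpos.le
    have hvec : ![v 0 / n, v 1 / n] = ((n : ℂ)⁻¹) • v := by
      funext i
      fin_cases i <;> simp [div_eq_inv_mul]
    refine ⟨v 0 / n, v 1 / n, ?_, ?_, ?_⟩
    · simp only [norm_div, Complex.norm_real, Real.norm_eq_abs, abs_of_pos hn, div_pow]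
      rw [hn2, ← add_div, div_self hpos.ne']
    · rw [hvec, Matrix.mulVec_smul, hμ]
      simp [div_eq_inv_mul]; ring
    · rw [hvec, Matrix.mulVec_smul, hμ]
      simp [div_eq_inv_mul]; ring
  set K : Matrix (Fin 2) (Fin 2) ℂ := !![a, -star b; b, star a] with hK
  set h := g * K with hh
  have hdetK : K.det = 1 := by
    have h' : a * star a + b * star b = 1 := by
      simp only [Complex.star_def, Complex.mul_conj, Complex.normSq_eq_norm_sq]
      exact_mod_cast hab
    rw [hK, Matrix.det_fin_two_of]
    linear_combination h'
  have hd : h 0 0 * h 1 1 - h 0 1 * h 1 0 = 1 := by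
    rw [← Matrix.det_fin_two, hh, Matrix.det_mul, hg, hdetK, one_mul]
  have hd' := congrArg star hd
  have ho : star (h 0 1) * h 0 0 + star (h 1 1) * h 1 0 = 0 := by
    simp [Matrix.mulVec, dotProduct, Matrix.mul_apply, Fin.sum_univ_two] at hμ1 hμ2
    simp [hh, hK, Matrix.mul_apply, Fin.sum_univ_two]
    linear_combination a * hμ2 - b * hμ1
  have ho' := congrArg star ho
  simp only [star_sub, star_mul', star_add, star_star, star_one, star_zero] at hd' ho'
  set n := ‖h 0 0‖ ^ 2 + ‖h 1 0‖ ^ 2 with hn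
  set m := ‖h 0 1‖ ^ 2 + ‖h 1 1‖ ^ 2 with hm
  have hnm : n * m = 1 := by
    have : ((n * m : ℝ) : ℂ) = 1 := by
      push_cast [hn, hm, ← Complex.normSq_eq_norm_sq, ← Complex.mul_conj]
      simp only [← Complex.star_def]
      linear_combination (star (h 0 0) * star (h 1 1) - star (h 0 1) * star (h 1 0)) * hd + hd' +
        (h 0 1 * star (h 0 0) + h 1 1 * star (h 1 0)) * ho
    exact_mod_cast this
  have hn0 : 0 < n := by
    have : 0 ≤ n := by positivity
    rcases this.eq_or_lt with h0 | h0
    · rw [← h0, zero_mul] at hnm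
      exact absurd hnm zero_ne_one
    · exact h0
  have hP : Real.exp (Real.log n / 2) ^ 2 = n := by
    rw [← Real.exp_nat_mul]
    push_cast
    rw [mul_div_cancel₀ _ two_ne_zero, Real.exp_log hn0]
  have hP' : Real.exp (-(Real.log n / 2)) ^ 2 = m := by
    rw [← Real.exp_nat_mul]
    push_cast
    rw [mul_neg, mul_div_cancel₀ _ two_ne_zero, Real.exp_neg, Real.exp_log hn0]
    exact (eq_inv_of_mul_eq_one_right hnm).symm
  refine ⟨Matrix.diagonal (fun a => (Real.exp (sgn a * (Real.log n / 2)) : ℂ)) * h.adjugate,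
    K.adjugate, Real.log n / 2, ?_, ⟨star a, star b, by simpa using hab, ?_⟩, ?_⟩
  · have hm0 : 0 ≤ m := by positivity
    intro i j
    rw [Matrix.diagonal_mul, Matrix.adjugate_fin_two, norm_mul, Complex.norm_real,
      Real.norm_eq_abs, Real.abs_exp]
    refine (sq_le_one_iff₀ (by positivity)).1 ?_
    rw [mul_pow]
    fin_cases i <;> fin_cases j <;> simp only [sgn] <;> simp [hP, hP'] <;>
      nlinarith [sq_nonneg ‖h 0 0‖, sq_nonneg ‖h 0 1‖, sq_nonneg ‖h 1 0‖, sq_nonneg ‖h 1 1‖]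
  · rw [hK, Matrix.adjugate_fin_two_of]
    simp [su]
  · rw [hh, Matrix.adjugate_mul_distrib, Matrix.mul_assoc, Matrix.mul_assoc,
      Matrix.adjugate_mul, hg, one_smul, Matrix.mul_one]

theorem exists_weights {T : Tensor} (hT : 0 ∈ closure {S | Rel T S}) :
    ∃ S, Rel T S ∧ ∃ x : Fin 4 → ℝ, ∀ w, S w ≠ 0 → 0 < ∑ s, sgn (w s) * x s := by
  have key : ∀ n : ℕ, ∃ (k : Fin 4 → Matrix (Fin 2) (Fin 2) ℂ) (x : Fin 4 → ℝ),
      k ∈ Set.univ.pi (fun _ => SU) ∧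
      ∀ w, Real.exp (∑ s, sgn (w s) * x s) * ‖act k T w‖ ≤ 16 / (n + 1) := by
    intro n
    obtain ⟨S, ⟨g, rfl⟩, hS⟩ := Metric.mem_closure_iff.1 hT (1 / (n + 1)) (by positivity)
    rw [dist_zero_left] at hS
    choose u k x hu hk hukx using fun s => exists_decomposition (g s).1 (g s).2
    refine ⟨k, x, fun s _ => hk s, fun w => ?_⟩
    have h1 : act u (act (fun s => (g s).1) T) =
        fun w => (∏ s, (Real.exp (sgn (w s) * x s) : ℂ)) * act k T w := by
      rw [← act_diagonal (fun s a => (Real.exp (sgn a * x s) : ℂ)), act_act, act_act]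
      congr 1
      funext s
      exact hukx s
    have h2 := (norm_le_pi_norm _ w).trans (norm_act_le u hu (act (fun s => (g s).1) T))
    rw [h1, norm_mul, norm_prod] at h2
    simp only [Complex.norm_real, Real.norm_eq_abs, Real.abs_exp, ← Real.exp_sum] at h2
    refine h2.trans ?_
    rw [div_eq_mul_one_div]
    gcongr
  choose k x hk hx using key
  have : FirstCountableTopology (Fin 4 → Matrix (Fin 2) (Fin 2) ℂ) :=
    inferInstanceAs (FirstCountableTopology (Fin 4 → Fin 2 → Fin 2 → ℂ))
  obtain ⟨κ, hκ, φ, hφ, hlim⟩ := (isCompact_univ_pi fun _ => isCompact_SU).tendsto_subseq hk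
  refine ⟨act κ T, ⟨fun s => ⟨κ s, det_of_mem_SU (hκ s trivial)⟩, rfl⟩, ?_⟩
  have hact : Filter.Tendsto (fun n => act (k (φ n)) T) Filter.atTop (nhds (act κ T)) := by
    exact ((continuous_act T).tendsto κ).comp hlim
  have hev : ∀ w, act κ T w ≠ 0 → ∀ᶠ n in Filter.atTop,
      ∑ s, sgn (w s) * x (φ n) s < 0 := by
    intro w hw
    have h1 : Filter.Tendsto (fun n => ‖act (k (φ n)) T w‖) Filter.atTop (nhds ‖act κ T w‖) :=
      ((tendsto_pi_nhds.1 hact) w).norm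
    have h2 : Filter.Tendsto (fun n : ℕ => (16 : ℝ) / ((φ n : ℕ) + 1)) Filter.atTop (nhds 0) := by
      have := (tendsto_one_div_add_atTop_nhds_zero_nat (𝕜 := ℝ)).const_mul 16
      simp only [mul_one_div, mul_zero] at this
      exact this.comp hφ.tendsto_atTop
    filter_upwards [h2.eventually_lt h1 (norm_pos_iff.2 hw)] with n hn
    by_contra! hle
    have h3 := hx (φ n) w
    have h4 : ‖act (k (φ n)) T w‖ ≤
        Real.exp (∑ s, sgn (w s) * x (φ n) s) * ‖act (k (φ n)) T w‖ :=
      le_mul_of_one_le_left (norm_nonneg _) (Real.one_le_exp hle)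
    linarith
  have hall : ∀ᶠ n in Filter.atTop, ∀ w, act κ T w ≠ 0 →
      ∑ s, sgn (w s) * x (φ n) s < 0 :=
    Filter.eventually_all.2 fun w => by
      by_cases hw : act κ T w = 0
      · simp [hw]
      · simpa [hw] using hev w hw
  obtain ⟨n, hn⟩ := hall.exists
  refine ⟨fun s => -x (φ n) s, fun w hw => ?_⟩
  have := hn w hw
  simp only [mul_neg, Finset.sum_neg_distrib]
  linarith

/-- Three families of words whose weights are linearly independent. -/
def frame (i : Fin 3) : Fin 4 → Word :=
  ![![![0, 0, 0, 1], ![0, 1, 1, 0], ![1, 0, 1, 0], ![1, 1, 0, 0]],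
    ![![0, 0, 0, 1], ![1, 0, 1, 0], ![1, 1, 0, 0], ![0, 0, 1, 0]],
    ![![0, 0, 0, 1], ![1, 0, 0, 0], ![0, 1, 0, 0], ![0, 0, 1, 0]]] i

theorem good_of_subset_frame {i : Fin 3} {S : Finset Word}
    (hS : S ⊆ Finset.univ.image (frame i)) : Good S := by
  have hdet : ∀ i, (Matrix.of fun j s => sgn (frame i j s)).det ≠ 0 := by decide +kernel
  exact good_of_det (frame i) (hdet i) S hS

/-- A tensor is standard if, up to the group and a permutation of the factors, it is the indicator
of a subset of one of the frames, which in the case of the second frame contains `1100`, and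
`0001` if it contains `1010`. -/
def Standard (T : Tensor) : Prop :=
  ∃ (σ : Equiv.Perm (Fin 4)) (i : Fin 3) (S : Finset Word),
    S ⊆ Finset.univ.image (frame i) ∧
      (i = 1 → ![1, 1, 0, 0] ∈ S ∧ (![1, 0, 1, 0] ∈ S → ![0, 0, 0, 1] ∈ S)) ∧
      Rel T (permute σ (ind S))

theorem Standard.of_rel {T S : Tensor} (h : Rel T S) (hS : Standard S) : Standard T := by
  obtain ⟨σ, i, A, hA, hA', hr⟩ := hS
  exact ⟨σ, i, A, hA, hA', h.trans hr⟩

theorem Standard.of_permute {T : Tensor} (τ : Equiv.Perm (Fin 4)) (h : Standard (permute τ T)) :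
    Standard T := by
  obtain ⟨σ, i, A, hA, hA', hr⟩ := h
  refine ⟨τ⁻¹ * σ, i, A, hA, hA', ?_⟩
  have := hr.permute τ⁻¹
  rwa [permute_permute, inv_mul_cancel, permute_one, permute_permute] at this

theorem standard_of_support {T : Tensor} (i : Fin 3)
    (h : ∀ w, T w ≠ 0 → w ∈ Finset.univ.image (frame i))
    (h' : i = 1 → T ![1, 1, 0, 0] ≠ 0 ∧ (T ![1, 0, 1, 0] ≠ 0 → T ![0, 0, 0, 1] ≠ 0)) :
    Standard T := by
  classical
  refine ⟨1, i, Finset.univ.filter fun w => T w ≠ 0, fun w hw => h w (by simpa using hw),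
    by simpa using h', ?_⟩
  refine good_of_subset_frame (i := i) (fun w hw => h w (by simpa using hw)) T fun w => ?_
  simp

theorem update_word (a b c d e : Fin 2) :
    Function.update ![a, b, c, d] 0 e = ![e, b, c, d] ∧
    Function.update ![a, b, c, d] 1 e = ![a, e, c, d] ∧
    Function.update ![a, b, c, d] 2 e = ![a, b, e, d] ∧
    Function.update ![a, b, c, d] 3 e = ![a, b, c, e] := by
  refine ⟨?_, ?_, ?_, ?_⟩ <;> funext i <;> fin_cases i <;> rfl

theorem exists_rel_zero (M : Matrix (Fin 2) (Fin 2) ℂ) (hM : M.det = 1) (T : Tensor) :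
    ∃ S, Rel T S ∧ ∀ a b c d,
      S ![a, b, c, d] = M a 0 * T ![0, b, c, d] + M a 1 * T ![1, b, c, d] := by
  refine ⟨_, rel_update 0 M hM T, fun a b c d => ?_⟩
  simp [(update_word _ _ _ _ _).1]

theorem exists_rel_one (M : Matrix (Fin 2) (Fin 2) ℂ) (hM : M.det = 1) (T : Tensor) :
    ∃ S, Rel T S ∧ ∀ a b c d,
      S ![a, b, c, d] = M b 0 * T ![a, 0, c, d] + M b 1 * T ![a, 1, c, d] := by
  refine ⟨_, rel_update 1 M hM T, fun a b c d => ?_⟩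
  simp [(update_word _ _ _ _ _).2.1]

theorem exists_rel_two (M : Matrix (Fin 2) (Fin 2) ℂ) (hM : M.det = 1) (T : Tensor) :
    ∃ S, Rel T S ∧ ∀ a b c d,
      S ![a, b, c, d] = M c 0 * T ![a, b, 0, d] + M c 1 * T ![a, b, 1, d] := by
  refine ⟨_, rel_update 2 M hM T, fun a b c d => ?_⟩
  simp [(update_word _ _ _ _ _).2.2.1]

theorem exists_rel_three (M : Matrix (Fin 2) (Fin 2) ℂ) (hM : M.det = 1) (T : Tensor) :
    ∃ S, Rel T S ∧ ∀ a b c d,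
      S ![a, b, c, d] = M d 0 * T ![a, b, c, 0] + M d 1 * T ![a, b, c, 1] := by
  refine ⟨_, rel_update 3 M hM T, fun a b c d => ?_⟩
  simp [(update_word _ _ _ _ _).2.2.2]

/-- An eight-parameter family of tensors containing a representative of every nilpotent orbit. -/
def fam (p a b c x y z t : ℂ) : Tensor := fun w =>
  (![![![![t, p], ![z, 0]], ![![y, 0], ![a, 0]]],
     ![![![x, 0], ![b, 0]], ![![c, 0], ![0, 0]]]] :
      Fin 2 → Fin 2 → Fin 2 → Fin 2 → ℂ) (w 0) (w 1) (w 2) (w 3)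

theorem eq_fam {T : Tensor} (h₁ : T ![1, 1, 1, 0] = 0) (h₂ : T ![0, 0, 1, 1] = 0)
    (h₃ : T ![0, 1, 0, 1] = 0) (h₄ : T ![0, 1, 1, 1] = 0) (h₅ : T ![1, 0, 0, 1] = 0)
    (h₆ : T ![1, 0, 1, 1] = 0) (h₇ : T ![1, 1, 0, 1] = 0) (h₈ : T ![1, 1, 1, 1] = 0) :
    T = fam (T ![0, 0, 0, 1]) (T ![0, 1, 1, 0]) (T ![1, 0, 1, 0]) (T ![1, 1, 0, 0])
      (T ![1, 0, 0, 0]) (T ![0, 1, 0, 0]) (T ![0, 0, 1, 0]) (T ![0, 0, 0, 0]) := by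
  funext w
  obtain ⟨a, b, c, d, rfl⟩ := exists_word w
  fin_cases a <;> fin_cases b <;> fin_cases c <;> fin_cases d <;> simp [fam, *]

theorem rel_fam_zero (k p a b c x y z t : ℂ) :
    Rel (fam p a b c x y z t) (fam p a b c x (y + k * c) (z + k * b) (t + k * x)) := by
  obtain ⟨S, hS, h⟩ := exists_rel_zero !![1, k; 0, 1] (by simp [Matrix.det_fin_two])
    (fam p a b c x y z t)
  convert hS using 1
  rw [eq_fam (T := S)] <;> simp [h, fam]

theorem rel_fam_one (k p a b c x y z t : ℂ) :
    Rel (fam p a b c x y z t) (fam p a b c (x + k * c) y (z + k * a) (t + k * y)) := by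
  obtain ⟨S, hS, h⟩ := exists_rel_one !![1, k; 0, 1] (by simp [Matrix.det_fin_two])
    (fam p a b c x y z t)
  convert hS using 1
  rw [eq_fam (T := S)] <;> simp [h, fam]

theorem rel_fam_two (k p a b c x y z t : ℂ) :
    Rel (fam p a b c x y z t) (fam p a b c (x + k * b) (y + k * a) z (t + k * z)) := by
  obtain ⟨S, hS, h⟩ := exists_rel_two !![1, k; 0, 1] (by simp [Matrix.det_fin_two])
    (fam p a b c x y z t)
  convert hS using 1
  rw [eq_fam (T := S)] <;> simp [h, fam]

theorem rel_fam_three (k p a b c x y z t : ℂ) :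
    Rel (fam p a b c x y z t) (fam p a b c x y z (t + k * p)) := by
  obtain ⟨S, hS, h⟩ := exists_rel_three !![1, k; 0, 1] (by simp [Matrix.det_fin_two])
    (fam p a b c x y z t)
  convert hS using 1
  rw [eq_fam (T := S)] <;> simp [h, fam]

/-- The cyclic permutation of the first three factors. -/
def cycle : Equiv.Perm (Fin 4) := Equiv.swap 0 1 * Equiv.swap 1 2

theorem permute_cycle_fam (p a b c x y z t : ℂ) :
    permute cycle (fam p a b c x y z t) = fam p c a b z x y t := by
  funext w
  obtain ⟨i, j, k, l, rfl⟩ := exists_word w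
  have h0 : cycle 0 = 1 := by decide
  have h1 : cycle 1 = 2 := by decide
  have h2 : cycle 2 = 0 := by decide
  have h3 : cycle 3 = 3 := by decide
  fin_cases i <;> fin_cases j <;> fin_cases k <;> fin_cases l <;>
    simp [permute, fam, h0, h1, h2, h3]

theorem standard_fam_corner (p a b c : ℂ) : Standard (fam p a b c 0 0 0 0) := by
  refine standard_of_support 0 (fun w => ?_) (absurd · (by decide))
  obtain ⟨i, j, k, l, rfl⟩ := exists_word w
  fin_cases i <;> fin_cases j <;> fin_cases k <;> fin_cases l <;> simp [fam] <;> intro _ <;> decide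

theorem standard_fam_mixed {p b c : ℂ} (hc : c ≠ 0) (hb : b ≠ 0 → p ≠ 0) (z : ℂ) :
    Standard (fam p 0 b c 0 0 z 0) := by
  refine standard_of_support 1 (fun w => ?_) 
    fun _ => ⟨by simpa [fam] using hc, by simpa [fam] using hb⟩
  obtain ⟨i, j, k, l, rfl⟩ := exists_word w
  fin_cases i <;> fin_cases j <;> fin_cases k <;> fin_cases l <;> simp [fam] <;> intro _ <;> decide

theorem standard_fam_star (p x y z : ℂ) : Standard (fam p 0 0 0 x y z 0) := by
  refine standard_of_support 2 (fun w => ?_) (absurd · (by decide))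
  obtain ⟨i, j, k, l, rfl⟩ := exists_word w
  fin_cases i <;> fin_cases j <;> fin_cases k <;> fin_cases l <;> simp [fam] <;> intro _ <;> decide

theorem standard_fam_of_ne {p : ℂ} (hp : p ≠ 0) (a b c x y z t : ℂ)
    (h : Standard (fam p a b c x y z 0)) : Standard (fam p a b c x y z t) := by
  refine .of_rel (rel_fam_three (-t / p) p a b c x y z t) ?_
  rwa [div_mul_cancel₀ _ hp, add_neg_cancel]

theorem standard_fam_of_zero_of_ne {p c : ℂ} (hp : p ≠ 0) (hc : c ≠ 0) (b x y z t : ℂ) :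
    Standard (fam p 0 b c x y z t) := by
  refine .of_rel (rel_fam_zero (-y / c) p 0 b c x y z t) ?_
  rw [div_mul_cancel₀ _ hc, add_neg_cancel]
  refine .of_rel (rel_fam_one (-x / c) _ _ _ _ _ _ _ _) ?_
  rw [div_mul_cancel₀ _ hc, add_neg_cancel, mul_zero, add_zero]
  exact standard_fam_of_ne hp _ _ _ _ _ _ _ (standard_fam_mixed hc (fun _ => hp) _)

theorem standard_fam {p : ℂ} (hp : p ≠ 0) (a b c x y z t : ℂ) :
    Standard (fam p a b c x y z t) := by
  by_cases ha : a = 0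
  · by_cases hc : c = 0
    · by_cases hb : b = 0
      · subst ha hb hc
        exact standard_fam_of_ne hp _ _ _ _ _ _ _ (standard_fam_star _ _ _ _)
      · subst hc ha
        refine .of_permute cycle ?_
        rw [permute_cycle_fam]
        exact standard_fam_of_zero_of_ne hp hb _ _ _ _ _
    · subst ha
      exact standard_fam_of_zero_of_ne hp hc _ _ _ _ _
  by_cases hb : b = 0
  · subst hb
    refine .of_permute cycle (.of_permute cycle ?_)
    rw [permute_cycle_fam, permute_cycle_fam]
    exact standard_fam_of_zero_of_ne hp ha _ _ _ _ _
  by_cases hc : c = 0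
  · subst hc
    refine .of_permute cycle ?_
    rw [permute_cycle_fam]
    exact standard_fam_of_zero_of_ne hp hb _ _ _ _ _
  obtain ⟨k, l, m, hx, hy, hz⟩ : ∃ k l m : ℂ,
      x + l * c + m * b = 0 ∧ y + k * c + m * a = 0 ∧ z + k * b + l * a = 0 := by
    refine ⟨(x * a - y * b - z * c) / (2 * b * c), (y * b - x * a - z * c) / (2 * a * c),
      (z * c - x * a - y * b) / (2 * a * b), ?_, ?_, ?_⟩ <;> field_simp <;> ring
  refine .of_rel (rel_fam_zero k _ _ _ _ _ _ _ _) (.of_rel (rel_fam_one l _ _ _ _ _ _ _ _)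
    (.of_rel (rel_fam_two m _ _ _ _ _ _ _ _) ?_))
  rw [hx, hy, hz]
  exact standard_fam_of_ne hp _ _ _ _ _ _ _ (standard_fam_corner _ _ _ _)

theorem exists_det_eq_one {u v : ℂ} (h : u ≠ 0 ∨ v ≠ 0) :
    ∃ M : Matrix (Fin 2) (Fin 2) ℂ, M.det = 1 ∧ M 1 0 = u ∧ M 1 1 = v := by
  by_cases hv : v = 0
  · have hu : u ≠ 0 := h.resolve_right (not_not.2 hv)
    exact ⟨!![0, -u⁻¹; u, v], by simp [Matrix.det_fin_two, hu], rfl, rfl⟩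
  · exact ⟨!![v⁻¹, 0; u, v], by simp [Matrix.det_fin_two, hv], rfl, rfl⟩

theorem exists_det_eq_one_annihilating (u v : ℂ) :
    ∃ M : Matrix (Fin 2) (Fin 2) ℂ, M.det = 1 ∧ M 1 0 * u + M 1 1 * v = 0 := by
  by_cases h : u = 0 ∧ v = 0
  · exact ⟨1, by simp, by simp [h]⟩
  · obtain ⟨M, hM, h0, h1⟩ := exists_det_eq_one (u := v) (v := -u) (by
      rw [neg_ne_zero]; tauto)
    exact ⟨M, hM, by rw [h0, h1]; ring⟩

theorem exists_root_of_quadratic (A B C : ℂ) :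
    ∃ u v : ℂ, (u ≠ 0 ∨ v ≠ 0) ∧ A * u ^ 2 + B * u * v + C * v ^ 2 = 0 := by
  by_cases hA : A = 0
  · exact ⟨1, 0, .inl one_ne_zero, by simp [hA]⟩
  · obtain ⟨r, hr⟩ := IsAlgClosed.exists_pow_nat_eq (B ^ 2 - 4 * A * C) two_pos
    refine ⟨(r - B) / (2 * A), 1, .inr one_ne_zero, ?_⟩
    field_simp
    linear_combination hr

theorem standard_of_zero_slice {T : Tensor} (hT : ∀ a b c, T ![a, b, c, 1] = 0) :
    Standard T := by
  obtain ⟨u, v, huv, hroot⟩ := exists_root_of_quadratic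
    (T ![0, 0, 0, 0] * T ![1, 1, 0, 0] - T ![0, 1, 0, 0] * T ![1, 0, 0, 0])
    (T ![0, 0, 0, 0] * T ![1, 1, 1, 0] + T ![0, 0, 1, 0] * T ![1, 1, 0, 0]
      - T ![0, 1, 0, 0] * T ![1, 0, 1, 0] - T ![0, 1, 1, 0] * T ![1, 0, 0, 0])
    (T ![0, 0, 1, 0] * T ![1, 1, 1, 0] - T ![0, 1, 1, 0] * T ![1, 0, 1, 0])
  obtain ⟨M, hM, hMu, hMv⟩ := exists_det_eq_one huv
  obtain ⟨T₁, hr₁, h₁⟩ := exists_rel_two M hM T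
  refine .of_rel hr₁ ?_
  have hz₁ : ∀ a b c, T₁ ![a, b, c, 1] = 0 := by simp [h₁, hT]
  have hdet : T₁ ![0, 0, 1, 0] * T₁ ![1, 1, 1, 0] = T₁ ![0, 1, 1, 0] * T₁ ![1, 0, 1, 0] := by
    simp only [h₁, hMu, hMv]
    linear_combination hroot
  obtain ⟨u', v', huv', hb₀, hb₁⟩ : ∃ u v : ℂ, (u ≠ 0 ∨ v ≠ 0) ∧
      u * T₁ ![0, 0, 1, 0] + v * T₁ ![1, 0, 1, 0] = 0 ∧
      u * T₁ ![0, 1, 1, 0] + v * T₁ ![1, 1, 1, 0] = 0 := by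
    by_cases h : T₁ ![1, 0, 1, 0] = 0 ∧ T₁ ![0, 0, 1, 0] = 0
    · by_cases h' : T₁ ![1, 1, 1, 0] = 0 ∧ T₁ ![0, 1, 1, 0] = 0
      · exact ⟨1, 0, by simp, by simp [h], by simp [h']⟩
      · exact ⟨T₁ ![1, 1, 1, 0], -T₁ ![0, 1, 1, 0], by rw [neg_ne_zero]; tauto,
          by simp [h], by ring⟩
    · exact ⟨T₁ ![1, 0, 1, 0], -T₁ ![0, 0, 1, 0], by rw [neg_ne_zero]; tauto,
          by ring, by linear_combination -hdet⟩
  obtain ⟨M', hM', hMu', hMv'⟩ := exists_det_eq_one huv'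
  obtain ⟨T₂, hr₂, h₂⟩ := exists_rel_zero M' hM' T₁
  refine .of_rel hr₂ ?_
  have hz₂ : ∀ a b c, T₂ ![a, b, c, 1] = 0 := by simp [h₂, hz₁]
  have hy₂ : ∀ b, T₂ ![1, b, 1, 0] = 0 := by
    intro b
    rw [h₂, hMu', hMv']
    fin_cases b
    exacts [hb₀, hb₁]
  obtain ⟨N, hN, hN0⟩ := exists_det_eq_one_annihilating (T₂ ![0, 0, 1, 0]) (T₂ ![0, 1, 1, 0])
  obtain ⟨T₃, hr₃, h₃⟩ := exists_rel_one N hN T₂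
  refine .of_rel hr₃ ?_
  have hz₃ : ∀ a b c, T₃ ![a, b, c, 1] = 0 := by simp [h₃, hz₂]
  have hy₃ : ∀ b, T₃ ![1, b, 1, 0] = 0 := by simp [h₃, hy₂]
  have hx₃ : T₃ ![0, 1, 1, 0] = 0 := by rw [h₃, hN0]
  by_cases hz : T₃ ![0, 0, 1, 0] = 0
  · obtain ⟨L, hL, hL0⟩ := exists_det_eq_one_annihilating (T₃ ![0, 1, 0, 0]) (T₃ ![1, 1, 0, 0])
    obtain ⟨T₄, hr₄, h₄⟩ := exists_rel_zero L hL T₃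
    refine .of_rel hr₄ ?_
    have hz₄ : ∀ a b c, T₄ ![a, b, c, 1] = 0 := by simp [h₄, hz₃]
    have hy₄ : ∀ a b, T₄ ![a, b, 1, 0] = 0 := by
      intro a b
      fin_cases b <;> simp [h₄, hy₃, hx₃, hz]
    have hx₄ : T₄ ![1, 1, 0, 0] = 0 := by rw [h₄, hL0]
    by_cases hx : T₄ ![1, 0, 0, 0] = 0
    · by_cases hy : T₄ ![0, 1, 0, 0] = 0
      · obtain ⟨T₅, hr₅, h₅⟩ := exists_rel_zero !![0, 1; -1, 0] (by simp [Matrix.det_fin_two]) T₄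
        refine .of_rel hr₅ ?_
        rw [eq_fam (T := T₅)] <;> simp [h₅, hz₄, hy₄, hx₄, hx, hy]
        exact standard_fam_star _ _ _ _
      · rw [eq_fam (T := T₄)] <;> simp only [hz₄, hy₄, hx₄]
        refine .of_rel (rel_fam_one (-T₄ ![0, 0, 0, 0] / T₄ ![0, 1, 0, 0]) _ _ _ _ _ _ _ _) ?_
        rw [div_mul_cancel₀ _ hy, add_neg_cancel, mul_zero, add_zero, add_zero]
        exact standard_fam_star _ _ _ _
    · rw [eq_fam (T := T₄)] <;> simp only [hz₄, hy₄, hx₄]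
      refine .of_rel (rel_fam_zero (-T₄ ![0, 0, 0, 0] / T₄ ![1, 0, 0, 0]) _ _ _ _ _ _ _ _) ?_
      rw [div_mul_cancel₀ _ hx, add_neg_cancel, mul_zero, add_zero, add_zero]
      exact standard_fam_star _ _ _ _
  · rw [eq_fam (T := T₃)] <;> simp only [hz₃, hy₃, hx₃]
    have kill : ∀ p a b c x y t, Standard (fam p a b c (x + -t / T₃ ![0, 0, 1, 0] * b)
        (y + -t / T₃ ![0, 0, 1, 0] * a) (T₃ ![0, 0, 1, 0]) 0) →
        Standard (fam p a b c x y (T₃ ![0, 0, 1, 0]) t) := by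
      intro p a b c x y t h
      refine .of_rel (rel_fam_two (-t / T₃ ![0, 0, 1, 0]) _ _ _ _ _ _ _ _) ?_
      rwa [div_mul_cancel₀ _ hz, add_neg_cancel]
    by_cases hc : T₃ ![1, 1, 0, 0] = 0
    · rw [hc]
      refine kill _ _ _ _ _ _ _ ?_
      simp only [mul_zero, add_zero]
      exact standard_fam_star _ _ _ _
    · refine .of_rel (rel_fam_zero (-T₃ ![0, 1, 0, 0] / T₃ ![1, 1, 0, 0]) _ _ _ _ _ _ _ _) ?_
      refine .of_rel (rel_fam_one (-T₃ ![1, 0, 0, 0] / T₃ ![1, 1, 0, 0]) _ _ _ _ _ _ _ _) ?_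
      simp only [div_mul_cancel₀ _ hc, add_neg_cancel, mul_zero, add_zero]
      refine kill _ _ _ _ _ _ _ ?_
      simp only [mul_zero, add_zero]
      exact standard_fam_mixed hc (by simp) _

theorem sgn_flipWord (f w : Word) (s : Fin 4) : sgn (flipWord f w s) = sgn (f s) * sgn (w s) := by
  simp only [flipWord, Pi.add_apply]
  generalize f s = a
  generalize w s = b
  revert a b
  decide

theorem exists_sorted_weights {T : Tensor} (hT : 0 ∈ closure {S | Rel T S}) :
    ∃ (S : Tensor) (τ : Equiv.Perm (Fin 4)) (x : Fin 4 → ℝ), Rel T (permute τ S) ∧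
      Monotone x ∧ (∀ s, 0 ≤ x s) ∧ ∀ w, S w ≠ 0 → 0 < ∑ s, sgn (w s) * x s := by
  obtain ⟨S, hS, x, hx⟩ := exists_weights hT
  set f : Word := fun s => if x s < 0 then 1 else 0 with hf
  obtain ⟨S', hS', hflip⟩ := exists_rel_flip f S
  set σ := Tuple.sort fun s => |x s|
  refine ⟨permute σ⁻¹ S', σ, fun s => |x (σ s)|, ?_, Tuple.monotone_sort fun s => |x s|,
    fun s => abs_nonneg _, fun w hw => ?_⟩
  · rw [permute_permute, mul_inv_cancel, permute_one]
    exact hS.trans hS'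
  · have h := hx _ ((hflip _).1 hw)
    refine h.trans_eq (Fintype.sum_equiv σ⁻¹ _ _ fun s => ?_)
    have h1 : ((sgn (f s) : ℤ) : ℝ) * x s = |x s| := by
      by_cases h0 : x s < 0
      · simp [hf, h0, sgn, abs_of_neg h0]
      · simp [hf, h0, sgn, abs_of_nonneg (not_lt.1 h0)]
    have h2 : σ (σ⁻¹ s) = s := σ.apply_symm_apply s
    simp only [sgn_flipWord, Function.comp_apply, h2, ← h1]
    push_cast
    ring

theorem standard_of_mem_closure {T : Tensor} (hT : 0 ∈ closure {S | Rel T S}) : Standard T := by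
  obtain ⟨S, τ, x, hS, hmono, hnn, hsupp⟩ := exists_sorted_weights hT
  refine .of_rel hS (.of_permute τ⁻¹ ?_)
  rw [permute_permute, inv_mul_cancel, permute_one]
  have h01 : x 0 ≤ x 1 := hmono (by decide)
  have h12 : x 1 ≤ x 2 := hmono (by decide)
  have h23 : x 2 ≤ x 3 := hmono (by decide)
  have h0 := hnn 0
  have hz : ∀ w, ∑ s, sgn (w s) * x s ≤ 0 → S w = 0 := fun w hw => by
    by_contra h
    exact (hsupp w h).not_ge hw
  simp only [Fin.sum_univ_four, sgn] at hz hsupp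
  have hz₁ : ∀ a, S ![a, 0, 1, 1] = 0 := fun a => hz _ (by fin_cases a <;> simp <;> linarith)
  have hz₂ : ∀ a, S ![a, 1, 0, 1] = 0 := fun a => hz _ (by fin_cases a <;> simp <;> linarith)
  have hz₃ : ∀ a, S ![a, 1, 1, 1] = 0 := fun a => hz _ (by fin_cases a <;> simp <;> linarith)
  clear hS
  obtain ⟨R, hR, hR₁, hR₂, hR₃, hR₄, hR₅⟩ : ∃ R, Rel S R ∧ (∀ a, R ![a, 0, 1, 1] = 0) ∧
      (∀ a, R ![a, 1, 0, 1] = 0) ∧ (∀ a, R ![a, 1, 1, 1] = 0) ∧ R ![1, 0, 0, 1] = 0 ∧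
      (R ![0, 0, 0, 1] ≠ 0 → R ![1, 1, 1, 0] = 0) := by
    by_cases h : S ![1, 0, 0, 1] = 0
    · refine ⟨S, Rel.refl S, hz₁, hz₂, hz₃, h, fun h' => hz _ ?_⟩
      have := hsupp _ h'
      simp at this ⊢
      linarith
    · have := hsupp _ h
      simp at this
      have h₁ : S ![0, 1, 1, 0] = 0 := hz _ (by simp; linarith)
      have h₂ : S ![1, 1, 1, 0] = 0 := hz _ (by simp; linarith)
      obtain ⟨M, hM, hM0⟩ := exists_det_eq_one_annihilating (S ![0, 0, 0, 1]) (S ![1, 0, 0, 1])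
      obtain ⟨R, hR, hR'⟩ := exists_rel_zero M hM S
      exact ⟨R, hR, by simp [hR', hz₁], by simp [hR', hz₂], by simp [hR', hz₃],
        by rw [hR', hM0], by simp [hR', h₁, h₂]⟩
  refine .of_rel hR ?_
  by_cases hp : R ![0, 0, 0, 1] = 0
  · refine standard_of_zero_slice fun a b c => ?_
    fin_cases a <;> fin_cases b <;> fin_cases c <;> simp [*]
  · rw [eq_fam (hR₅ hp) (hR₁ 0) (hR₂ 0) (hR₃ 0) hR₄ (hR₁ 1) (hR₂ 1) (hR₃ 1)]
    exact standard_fam hp _ _ _ _ _ _ _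

/-- The word with a given binary code. -/
def word (n : ℕ) : Word := fun s => if n.testBit (3 - s) then 1 else 0

/-- The set of words with codes in a list. -/
def wordSet (L : List ℕ) : Finset Word := (L.map word).toFinset

/-- The codes of the words in the frames. -/
def frameCode : Fin 3 → List ℕ := ![[1, 6, 10, 12], [1, 10, 12, 2], [1, 8, 4, 2]]

/-- The supports of the representatives of the nilpotent orbits. -/
def repCode : Fin 30 → List ℕ :=
  ![[0], [0, 12], [0, 3], [0, 10], [0, 5], [0, 9], [0, 6], [0, 6, 10], [0, 5, 9], [0, 3, 9],
    [0, 3, 5], [0, 14], [0, 13], [0, 11], [0, 7], [0, 3, 5, 9], [0, 3, 13], [0, 7, 11],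
    [0, 5, 11], [0, 7, 10], [0, 6, 11], [0, 7, 9], [0, 3, 8, 13], [0, 3, 4, 13], [0, 2, 5, 11],
    [0, 1, 6, 11], [0, 6, 10, 13], [0, 5, 9, 14], [0, 3, 9, 14], [0, 3, 5, 14]]

/-- The code of the word obtained by permuting the letters of a word with a given code. -/
def permCode (σ : Equiv.Perm (Fin 4)) (n : ℕ) : ℕ :=
  (n.testBit 3).toNat <<< (3 - (σ 0).val) + (n.testBit 2).toNat <<< (3 - (σ 1).val) +
    (n.testBit 1).toNat <<< (3 - (σ 2).val) + (n.testBit 0).toNat <<< (3 - (σ 3).val)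

/-- Check whether two sets of codes agree up to a flip. -/
def matchCode (L R : List ℕ) : Bool :=
  L.any fun f => (L.all fun n => R.contains (f ^^^ n)) && R.all fun n => L.contains (f ^^^ n)

theorem word_permCode (σ : Equiv.Perm (Fin 4)) {n : ℕ} (hn : n < 16) :
    word (permCode σ n) = word n ∘ (σ⁻¹ : Equiv.Perm (Fin 4)) := by
  have h : ∀ (σ : Equiv.Perm (Fin 4)) (n : Fin 16),
      word (permCode σ n) = word n ∘ (σ⁻¹ : Equiv.Perm (Fin 4)) := by decide +kernel
  exact h σ ⟨n, hn⟩

theorem permCode_lt (σ : Equiv.Perm (Fin 4)) {n : ℕ} (hn : n < 16) : permCode σ n < 16 := by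
  have h : ∀ (σ : Equiv.Perm (Fin 4)) (n : Fin 16), permCode σ n < 16 := by decide +kernel
  exact h σ ⟨n, hn⟩

theorem word_xor {f n : ℕ} (hf : f < 16) (hn : n < 16) :
    word (f ^^^ n) = flipWord (word f) (word n) := by
  have h : ∀ f n : Fin 16, word (f.val ^^^ n.val) = flipWord (word f) (word n) := by decide +kernel
  exact h ⟨f, hf⟩ ⟨n, hn⟩

theorem mem_wordSet {L : List ℕ} {w : Word} : w ∈ wordSet L ↔ ∃ n ∈ L, word n = w := by
  simp [wordSet]

theorem exists_flip_of_matchCode {σ : Equiv.Perm (Fin 4)} {L R : List ℕ} (hL : ∀ n ∈ L, n < 16)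
    (hR : ∀ n ∈ R, n < 16) (h : matchCode (L.map (permCode σ)) R) :
    ∃ f, ∀ w : Word, w ∘ σ ∈ wordSet L ↔ flipWord f w ∈ wordSet R := by
  simp only [matchCode, List.any_eq_true, Bool.and_eq_true, List.all_eq_true,
    List.contains_iff_mem] at h
  obtain ⟨f, hf, h₁, h₂⟩ := h
  have hlt : ∀ n ∈ L.map (permCode σ), n < 16 := by
    intro n hn
    obtain ⟨m, hm, rfl⟩ := List.mem_map.1 hn
    exact permCode_lt σ (hL m hm)
  refine ⟨word f, fun w => ⟨fun hw => ?_, fun hw => ?_⟩⟩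
  · obtain ⟨n, hn, hnw⟩ := mem_wordSet.1 hw
    have hn' := List.mem_map_of_mem (f := permCode σ) hn
    refine mem_wordSet.2 ⟨_, h₁ _ hn', ?_⟩
    rw [word_xor (hlt _ hf) (hlt _ hn'), word_permCode σ (hL n hn), hnw]
    congr 1
    funext s
    exact congrArg w (σ.apply_symm_apply s)
  · obtain ⟨m, hm, hmw⟩ := mem_wordSet.1 hw
    obtain ⟨n, hn, hnm⟩ := List.mem_map.1 (h₂ m hm)
    refine mem_wordSet.2 ⟨n, hn, ?_⟩
    have := word_permCode σ (hL n hn)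
    rw [hnm, word_xor (hlt _ hf) (hR m hm), hmw, flipWord_flipWord] at this
    rw [this]
    funext s
    exact congrArg (word n) (σ.symm_apply_apply s).symm

theorem Good.rel_of_flip {S R : Finset Word} (hS : Good S) {σ : Equiv.Perm (Fin 4)} {f : Word}
    (h : ∀ w : Word, w ∘ σ ∈ S ↔ flipWord f w ∈ R) {T : Tensor} (hT : ∀ w, T w ≠ 0 ↔ w ∈ R) :
    Rel T (permute σ (ind S)) := by
  obtain ⟨T', hr, hT'⟩ := exists_rel_flip f T
  have := (hS (permute σ⁻¹ T') fun w => by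
    rw [permute, hT', hT, ← h]
    refine iff_of_eq (congrArg (· ∈ S) (funext fun s => ?_))
    exact congrArg w (σ.symm_apply_apply s)).permute σ
  rw [permute_permute, mul_inv_cancel, permute_one] at this
  exact hr.trans this

theorem ind_ne_zero_iff (S : Finset Word) (w : Word) : ind S w ≠ 0 ↔ w ∈ S := by
  simp [ind]

theorem Good.of_flip {S R : Finset Word} (hS : Good S) {σ : Equiv.Perm (Fin 4)} {f : Word}
    (h : ∀ w : Word, w ∘ σ ∈ S ↔ flipWord f w ∈ R) : Good R := fun _ hT =>
  (hS.rel_of_flip h hT).trans (hS.rel_of_flip h (ind_ne_zero_iff R)).symm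

theorem lt_of_mem_repCode : ∀ j, ∀ n ∈ repCode j, n < 16 := by decide +kernel

theorem lt_of_mem_frameCode : ∀ i, ∀ n ∈ frameCode i, n < 16 := by decide +kernel

theorem wordSet_frameCode : ∀ i, wordSet (frameCode i) = Finset.univ.image (frame i) := by
  decide +kernel

theorem good_wordSet {i : Fin 3} {L : List ℕ} (hL : ∀ n ∈ L, n ∈ frameCode i) :
    Good (wordSet L) := by
  refine good_of_subset_frame (i := i) fun w hw => ?_
  obtain ⟨n, hn, rfl⟩ := mem_wordSet.1 hw
  rw [← wordSet_frameCode]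
  exact mem_wordSet.2 ⟨n, hL n hn, rfl⟩

theorem rel_rep_of_matchCode {i : Fin 3} {L : List ℕ} (hL : ∀ n ∈ L, n ∈ frameCode i)
    {σ : Equiv.Perm (Fin 4)} {j : Fin 30} (h : matchCode (L.map (permCode σ)) (repCode j)) :
    Rel (permute σ (ind (wordSet L))) (ind (wordSet (repCode j))) := by
  obtain ⟨f, hf⟩ := exists_flip_of_matchCode (fun n hn => lt_of_mem_frameCode i n (hL n hn))
    (lt_of_mem_repCode j) h
  exact ((good_wordSet hL).rel_of_flip hf (ind_ne_zero_iff _)).symm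

theorem good_rep (j : Fin 30) : Good (wordSet (repCode j)) := by
  have h : ∀ j, ∃ i, ∃ L ∈ (frameCode i).sublists, ∃ σ,
      matchCode (L.map (permCode σ)) (repCode j) := by decide +kernel
  obtain ⟨i, L, hL, σ, h⟩ := h j
  rw [List.mem_sublists] at hL
  obtain ⟨f, hf⟩ := exists_flip_of_matchCode
    (fun n hn => lt_of_mem_frameCode i n (hL.subset hn)) (lt_of_mem_repCode j) h
  exact (good_wordSet fun n hn => hL.subset hn).of_flip hf

theorem rel_mixed_swap :
    Rel (ind (wordSet (frameCode 1))) (permute (Equiv.swap 1 2) (ind (wordSet (frameCode 1)))) := by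
  have h₁ : ind (wordSet (frameCode 1)) = fam 1 0 1 1 0 0 1 0 := by
    funext w
    have : ∀ w : Word, w ∈ wordSet (frameCode 1) ↔ w = ![0, 0, 0, 1] ∨ w = ![1, 0, 1, 0] ∨
        w = ![1, 1, 0, 0] ∨ w = ![0, 0, 1, 0] := by decide +kernel
    simp only [ind, this]
    obtain ⟨a, b, c, d, rfl⟩ := exists_word w
    fin_cases a <;> fin_cases b <;> fin_cases c <;> fin_cases d <;> simp [fam]
  have h₂ : Rel (ind (wordSet (frameCode 1))) (fam 1 0 1 1 0 (-1) 0 0) := by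
    rw [h₁]
    simpa using rel_fam_zero (-1) 1 0 1 1 0 0 1 0
  have h₃ : Rel (permute (Equiv.swap 1 2) (fam 1 0 1 1 0 (-1) 0 0))
      (ind (wordSet (frameCode 1))) := by
    refine good_wordSet (i := 1) (fun n hn => hn) _ fun w => ?_
    rw [← ind_ne_zero_iff, h₁]
    obtain ⟨a, b, c, d, rfl⟩ := exists_word w
    have e1 : Equiv.swap (1 : Fin 4) 2 0 = 0 := by decide
    have e3 : Equiv.swap (1 : Fin 4) 2 3 = 3 := by decide
    fin_cases a <;> fin_cases b <;> fin_cases c <;> fin_cases d <;> simp [fam, permute, e1, e3]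
  refine h₂.trans ?_
  have := h₃.permute (Equiv.swap 1 2)
  rwa [permute_permute, Equiv.swap_mul_self, permute_one] at this

theorem rel_mixed_flip :
    Rel (ind (wordSet (frameCode 1))) (permute (Equiv.swap 1 3) (ind (wordSet (frameCode 1)))) := by
  have h : ∀ w : Word, w ∘ Equiv.swap 1 3 ∈ wordSet (frameCode 1) ↔
      flipWord ![1, 0, 0, 0] w ∈ wordSet (frameCode 1) := by decide +kernel
  exact (good_wordSet (i := 1) fun n hn => hn).rel_of_flip h (ind_ne_zero_iff _)

theorem exists_rel_rep_mixed (σ : Equiv.Perm (Fin 4)) :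
    ∃ j, Rel (permute σ (ind (wordSet (frameCode 1)))) (ind (wordSet (repCode j))) := by
  have h : ∀ σ, ∃ j, matchCode ((frameCode 1).map (permCode σ)) (repCode j) ∨
      matchCode ((frameCode 1).map (permCode (σ * Equiv.swap 1 2))) (repCode j) ∨
      matchCode ((frameCode 1).map
        (permCode (σ * Equiv.swap 1 2 * Equiv.swap 1 3 * Equiv.swap 1 2)))
        (repCode j) := by decide +kernel
  obtain ⟨j, h | h | h⟩ := h σ
  · exact ⟨j, rel_rep_of_matchCode (i := 1) (fun _ hn => hn) h⟩
  · refine ⟨j, (rel_mixed_swap.permute σ).trans ?_⟩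
    rw [permute_permute]
    exact rel_rep_of_matchCode (i := 1) (fun _ hn => hn) h
  · refine ⟨j, (rel_mixed_swap.permute σ).trans ?_⟩
    rw [permute_permute]
    refine (rel_mixed_flip.permute _).trans ?_
    rw [permute_permute]
    refine (rel_mixed_swap.permute _).trans ?_
    rw [permute_permute]
    exact rel_rep_of_matchCode (i := 1) (fun _ hn => hn) h

theorem Standard.exists_rel_rep {T : Tensor} (hT : Standard T) (h₀ : T ≠ 0) :
    ∃ j, Rel T (ind (wordSet (repCode j))) := by
  obtain ⟨σ, i, S, hS, hi, hr⟩ := hT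
  set L := (frameCode i).filter fun n => word n ∈ S with hL
  have hLS : wordSet L = S := by
    ext w
    simp only [mem_wordSet, hL, List.mem_filter, decide_eq_true_eq]
    refine ⟨fun ⟨n, hn, hw⟩ => hw ▸ hn.2, fun hw => ?_⟩
    have := hS hw
    rw [← wordSet_frameCode, mem_wordSet] at this
    obtain ⟨n, hn, rfl⟩ := this
    exact ⟨n, ⟨hn, hw⟩, rfl⟩
  have hsub : L.Sublist (frameCode i) := List.filter_sublist
  have hne : L ≠ [] := by
    intro h
    refine (hr.ne_zero h₀) (funext fun w => ?_)
    rw [← hLS, h]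
    simp [permute, ind, wordSet]
  have hcode : i = 1 → 12 ∈ L ∧ (10 ∈ L → 1 ∈ L) := by
    rintro rfl
    have h := hi rfl
    rw [show ![1, 1, 0, 0] = word 12 by decide, show ![1, 0, 1, 0] = word 10 by decide,
      show ![0, 0, 0, 1] = word 1 by decide] at h
    simpa [hL, frameCode] using h
  clear_value L
  subst hLS
  by_cases hmixed : L = frameCode 1
  · obtain ⟨j, hj⟩ := exists_rel_rep_mixed σ
    exact ⟨j, hr.trans (hmixed ▸ hj)⟩
  have key : ∀ i, ∀ L ∈ (frameCode i).sublists, L ≠ [] → (i = 1 → 12 ∈ L ∧ (10 ∈ L → 1 ∈ L)) →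
      L ≠ frameCode 1 → ∀ σ, ∃ j, matchCode (L.map (permCode σ)) (repCode j) := by
    decide +kernel
  obtain ⟨j, hj⟩ := key i L (List.mem_sublists.2 hsub) hne hcode hmixed σ
  exact ⟨j, hr.trans (rel_rep_of_matchCode (fun n hn => hsub.subset hn) hj)⟩

open Matrix Kronecker

/-- The index set of the flattenings of a tensor. -/
abbrev Pair : Type := Fin 2 × Fin 2

/-- The invariant bilinear form on the tensor product of two factors. -/
def form : Matrix Pair Pair ℂ := !![0, 1; -1, 0] ⊗ₖ !![0, 1; -1, 0]

/-- The flattening of a tensor along the first two and the last two factors. -/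
def flatten (T : Tensor) : Matrix Pair Pair ℂ := .of fun r c => T ![r.1, r.2, c.1, c.2]

/-- The quadratic covariant of a tensor with values in the square of the first two factors. -/
def cov (T : Tensor) : Matrix Pair Pair ℂ := flatten T * form * (flatten T)ᵀ

/-- Properties of a matrix which are invariant under isometries of `form`. -/
def MatProp (X : Matrix Pair Pair ℂ) : Fin 4 → Prop :=
  ![X = 0, ∃ u v, X = vecMulVec u v, X * form * X = 0, X * form * X * form * X = 0]

theorem flatten_act (g : Fin 4 → Matrix (Fin 2) (Fin 2) ℂ) (T : Tensor) :
    flatten (act g T) = (g 0 ⊗ₖ g 1) * flatten T * (g 2 ⊗ₖ g 3)ᵀ := by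
  ext r c
  simp only [flatten, act, of_apply, sum_word, Fin.prod_univ_four, mul_apply, Fintype.sum_prod_type,
    transpose_apply, kroneckerMap_apply, Fin.sum_univ_two]
  simp
  ring

theorem transpose_mul_eps_mul {g : Matrix (Fin 2) (Fin 2) ℂ} (hg : g.det = 1) :
    gᵀ * !![0, 1; -1, 0] * g = !![0, 1; -1, 0] := by
  rw [det_fin_two] at hg
  ext i j
  fin_cases i <;> fin_cases j <;> simp [mul_apply, Fin.sum_univ_two]
  · ring
  · linear_combination hg
  · linear_combination -hg
  · ring

theorem transpose_mul_form_mul {g h : Matrix (Fin 2) (Fin 2) ℂ} (hg : g.det = 1)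
    (hh : h.det = 1) : (g ⊗ₖ h)ᵀ * form * (g ⊗ₖ h) = form := by
  rw [form, ← kroneckerMap_transpose, ← mul_kronecker_mul, ← mul_kronecker_mul,
    transpose_mul_eps_mul hg, transpose_mul_eps_mul hh]

theorem Rel.exists_cov_eq {T S : Tensor} (h : Rel T S) :
    ∃ P, Pᵀ * form * P = form ∧ cov S = P * cov T * Pᵀ := by
  obtain ⟨g, rfl⟩ := h
  refine ⟨(g 0).1 ⊗ₖ (g 1).1, transpose_mul_form_mul (g 0).2 (g 1).2, ?_⟩
  have hQ := transpose_mul_form_mul (g 2).2 (g 3).2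
  simp only [cov, flatten_act, transpose_mul, transpose_transpose]
  conv_rhs => rw [← hQ]
  simp only [Matrix.mul_assoc]

theorem MatProp.congr {X P : Matrix Pair Pair ℂ} (hP : Pᵀ * form * P = form) {k : Fin 4}
    (h : MatProp X k) : MatProp (P * X * Pᵀ) k := by
  have hmul : ∀ Y, P * Y * Pᵀ * form * (P * X * Pᵀ) = P * (Y * form * X) * Pᵀ := by
    intro Y
    conv_rhs => rw [← hP]
    simp only [Matrix.mul_assoc]
  fin_cases k <;> simp only [MatProp] at h ⊢ <;> simp at h ⊢
  · simp [h]
  · obtain ⟨u, v, rfl⟩ := h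
    exact ⟨P *ᵥ u, v ᵥ* Pᵀ, by rw [mul_vecMulVec, vecMulVec_mul]⟩
  · simp [hmul, h]
  · simp [hmul, h]

theorem matProp_iff_of_rel {T S : Tensor} (h : Rel T S) (σ : Equiv.Perm (Fin 4)) (k : Fin 4) :
    MatProp (cov (permute σ T)) k ↔ MatProp (cov (permute σ S)) k := by
  have key : ∀ {T S : Tensor}, Rel T S → MatProp (cov (permute σ T)) k →
      MatProp (cov (permute σ S)) k := by
    intro T S h hT
    obtain ⟨P, hP, hS⟩ := (h.permute σ).exists_cov_eq
    rw [hS]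
    exact hT.congr hP
  exact ⟨key h, key h.symm⟩

/-- An integer matrix stored as a list of entries. -/
abbrev Sparse : Type := List (Pair × Pair × ℤ)

/-- An entry of a matrix stored as a list. -/
def Sparse.entry (L : Sparse) (r c : Pair) : ℤ :=
  (L.map fun e => if e.1 = r ∧ e.2.1 = c then e.2.2 else 0).sum

/-- The complex matrix given by a list of entries. -/
def Sparse.toMatrix (L : Sparse) : Matrix Pair Pair ℂ :=
  (L.map fun e => single e.1 e.2.1 (e.2.2 : ℂ)).sum

/-- The product `L * form * M`. -/
def Sparse.mul (L M : Sparse) : Sparse :=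
  L.flatMap fun a => (M.filter fun b => b.1 = a.2.1 + 1).map fun b =>
    (a.1, b.2.1, a.2.2 * (sgn a.2.1.1 * sgn a.2.1.2) * b.2.2)

/-- The transpose of a matrix stored as a list. -/
def Sparse.transpose (L : Sparse) : Sparse := L.map fun e => (e.2.1, e.1, e.2.2)

/-- The flattening of the indicator of the words with given codes. -/
def Sparse.ofCodes (L : List ℕ) : Sparse :=
  L.map fun n => ((word n 0, word n 1), (word n 2, word n 3), 1)

/-- Decide the properties of the matrix given by a list of entries. -/
def Sparse.check (X : Sparse) : Fin 4 → Bool :=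
  ![decide (∀ r c, X.entry r c = 0),
    decide (∀ r r' c c', X.entry r c * X.entry r' c' = X.entry r c' * X.entry r' c),
    decide (∀ r c, (X.mul X).entry r c = 0),
    decide (∀ r c, ((X.mul X).mul X).entry r c = 0)]

theorem Sparse.toMatrix_cons (a : Pair × Pair × ℤ) (L : Sparse) :
    Sparse.toMatrix (a :: L) = single a.1 a.2.1 (a.2.2 : ℂ) + L.toMatrix := by
  simp [toMatrix]

theorem Sparse.toMatrix_apply (L : Sparse) (r c : Pair) : L.toMatrix r c = L.entry r c := by
  induction L with
  | nil => simp [toMatrix, entry]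
  | cons a L ih =>
    have hent : Sparse.entry (a :: L) r c =
        (if a.1 = r ∧ a.2.1 = c then a.2.2 else 0) + Sparse.entry L r c := by
      simp [entry]
    rw [toMatrix_cons, hent, Matrix.add_apply, Int.cast_add, ih]
    congr 1
    simp only [single, of_apply]
    split_ifs <;> simp

theorem Sparse.toMatrix_eq_zero_iff (L : Sparse) : L.toMatrix = 0 ↔ ∀ r c, L.entry r c = 0 := by
  simp only [← Matrix.ext_iff, toMatrix_apply, Matrix.zero_apply, Int.cast_eq_zero]

theorem Sparse.toMatrix_transpose (L : Sparse) : L.transpose.toMatrix = L.toMatrixᵀ := by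
  ext r c
  simp only [transpose_apply, toMatrix_apply, entry, Sparse.transpose, List.map_map]
  congr 3
  funext e
  simp [and_comm]

theorem form_apply (a b : Pair) :
    form a b = if b = a + 1 then ((sgn a.1 * sgn a.2 : ℤ) : ℂ) else 0 := by
  obtain ⟨a₁, a₂⟩ := a
  obtain ⟨b₁, b₂⟩ := b
  fin_cases a₁ <;> fin_cases a₂ <;> fin_cases b₁ <;> fin_cases b₂ <;>
    simp [form, sgn, Prod.ext_iff]

theorem Sparse.toMatrix_append (L M : Sparse) :
    Sparse.toMatrix (L ++ M) = L.toMatrix + M.toMatrix := by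
  simp [toMatrix]

theorem Sparse.toMatrix_mul (L M : Sparse) :
    (L.mul M).toMatrix = L.toMatrix * form * M.toMatrix := by
  induction L with
  | nil => simp [toMatrix, Sparse.mul]
  | cons a L ih =>
    have hcons : Sparse.mul (a :: L) M = Sparse.mul [a] M ++ Sparse.mul L M := by
      simp [Sparse.mul]
    rw [hcons, toMatrix_append, toMatrix_cons, ih, Matrix.add_mul, Matrix.add_mul]
    congr 1
    clear hcons ih
    induction M with
    | nil => simp [toMatrix, Sparse.mul]
    | cons b M ih =>
      have hcons : Sparse.mul [a] (b :: M) = Sparse.mul [a] [b] ++ Sparse.mul [a] M := by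
        by_cases h : b.1 = a.2.1 + 1 <;> simp [Sparse.mul, h]
      rw [hcons, toMatrix_append, toMatrix_cons, ih, Matrix.mul_add, single_mul_mul_single,
        form_apply]
      congr 1
      by_cases h : b.1 = a.2.1 + 1 <;> simp [toMatrix, Sparse.mul, h]

theorem exists_eq_vecMulVec_iff {X : Matrix Pair Pair ℂ} :
    (∃ u v, X = vecMulVec u v) ↔ ∀ r r' c c', X r c * X r' c' = X r c' * X r' c := by
  constructor
  · rintro ⟨u, v, rfl⟩ r r' c c'
    simp only [vecMulVec_apply]
    ring
  · intro h
    by_cases h0 : X = 0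
    · exact ⟨0, 0, by simp [h0]⟩
    · obtain ⟨r, c, hrc⟩ : ∃ r c, X r c ≠ 0 := by
        by_contra! h'
        exact h0 (Matrix.ext h')
      refine ⟨fun r' => X r' c / X r c, fun c' => X r c', ?_⟩
      ext r' c'
      rw [vecMulVec_apply]
      field_simp
      linear_combination h r' r c' c

theorem Sparse.matProp_iff (X : Sparse) (k : Fin 4) : MatProp X.toMatrix k ↔ X.check k := by
  have h2 : X.toMatrix * form * X.toMatrix = (X.mul X).toMatrix := (toMatrix_mul _ _).symm
  have h3 : X.toMatrix * form * X.toMatrix * form * X.toMatrix = ((X.mul X).mul X).toMatrix := by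
    rw [toMatrix_mul (X.mul X) X, toMatrix_mul X X]
  fin_cases k
  · simp [MatProp, check, toMatrix_eq_zero_iff]
  · simp only [MatProp, check]
    simp [exists_eq_vecMulVec_iff, toMatrix_apply]
    norm_cast
  · simp [MatProp, check, h2, toMatrix_eq_zero_iff]
  · simp [MatProp, check, h3, toMatrix_eq_zero_iff]

theorem flatten_ind {L : List ℕ} (hL : (L.map word).Nodup) :
    flatten (ind (wordSet L)) = (Sparse.ofCodes L).toMatrix := by
  ext r c
  obtain ⟨r₁, r₂⟩ := r
  obtain ⟨c₁, c₂⟩ := c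
  rw [Sparse.toMatrix_apply, flatten, of_apply]
  induction L with
  | nil => simp [ind, wordSet, Sparse.entry, Sparse.ofCodes]
  | cons n L ih =>
    rw [List.map_cons, List.nodup_cons] at hL
    have h : Sparse.entry (Sparse.ofCodes (n :: L)) (r₁, r₂) (c₁, c₂) =
        (if word n = ![r₁, r₂, c₁, c₂] then 1 else 0) +
          Sparse.entry (Sparse.ofCodes L) (r₁, r₂) (c₁, c₂) := by
      simp only [Sparse.entry, Sparse.ofCodes, List.map_cons, List.sum_cons]
      congr 1
      refine if_congr ?_ rfl rfl
      simp [funext_iff, Fin.forall_fin_succ, and_assoc]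
    rw [h, Int.cast_add, ← ih hL.2]
    by_cases hn : word n = ![r₁, r₂, c₁, c₂]
    · have h₁ : ![r₁, r₂, c₁, c₂] ∉ wordSet L := by
        rw [← hn]
        simpa [wordSet] using hL.1
      have h₂ : ![r₁, r₂, c₁, c₂] ∈ wordSet (n :: L) := by
        rw [← hn]
        simp [wordSet]
      simp [ind, h₁, h₂, hn]
    · have h₂ : ![r₁, r₂, c₁, c₂] ∈ wordSet (n :: L) ↔ ![r₁, r₂, c₁, c₂] ∈ wordSet L := by
        simp [wordSet, Ne.symm hn]
      simp [ind, h₂, hn]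

theorem permute_ind {L : List ℕ} (hL : ∀ n ∈ L, n < 16) (σ : Equiv.Perm (Fin 4)) :
    permute σ (ind (wordSet L)) = ind (wordSet (L.map (permCode σ))) := by
  funext w
  refine if_congr ?_ rfl rfl
  simp only [mem_wordSet, List.mem_map, exists_exists_and_eq_and]
  refine exists_congr fun n => and_congr_right fun hn => ?_
  rw [word_permCode σ (hL n hn)]
  constructor
  · intro h
    rw [h]
    funext s
    exact congrArg w (σ.apply_symm_apply s)
  · rintro rfl
    funext s
    exact congrArg (word n) (σ.symm_apply_apply s).symm

/-- Permutations of the factors bringing each pair of factors to the front. -/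
def rowPerm : Fin 6 → Equiv.Perm (Fin 4) :=
  ![1, Equiv.swap 0 2 * Equiv.swap 1 3, Equiv.swap 1 2, Equiv.swap 1 3, Equiv.swap 0 2,
    Equiv.swap 0 3]

/-- The covariant of a representative, as a list of entries. -/
def repCov (j : Fin 30) (i : Fin 6) : Sparse :=
  let A := Sparse.ofCodes ((repCode j).map (permCode (rowPerm i)))
  A.mul A.transpose

theorem cov_rep (j : Fin 30) (i : Fin 6) :
    cov (permute (rowPerm i) (ind (wordSet (repCode j)))) = (repCov j i).toMatrix := by
  have h : ∀ j i, (((repCode j).map (permCode (rowPerm i))).map word).Nodup := by decide +kernel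
  rw [repCov, Sparse.toMatrix_mul, Sparse.toMatrix_transpose, ← flatten_ind (h j i),
    ← permute_ind (lt_of_mem_repCode j)]
  rfl

/-- The invariants of the representatives, encoded in binary. -/
def repSignature : Fin 30 → ℕ :=
  ![16777215, 16777199, 16777214, 15728639, 16776959, 16711679, 16773119, 15724527, 16711407,
    15663102, 16772862, 13619151, 16579791, 13434876, 16764156, 15658734, 13421710, 13421800,
    9227980, 15517900, 13167820, 13536460, 8965260, 13404300, 9211080, 13158600, 526344,
    8421384, 34944, 8913024]

theorem check_repCov :
    ∀ j i k, (repCov j i).check k = (repSignature j).testBit (4 * i.val + k.val) := by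
  decide +kernel

theorem eq_of_rel_rep {j j' : Fin 30}
    (h : Rel (ind (wordSet (repCode j))) (ind (wordSet (repCode j')))) : j = j' := by
  have hinj : ∀ j j', (∀ (i : Fin 6) (k : Fin 4), (repSignature j).testBit (4 * i.val + k.val) =
      (repSignature j').testBit (4 * i.val + k.val)) → j = j' := by decide +kernel
  refine hinj j j' fun i k => ?_
  have := matProp_iff_of_rel h (rowPerm i) k
  rw [cov_rep, cov_rep, Sparse.matProp_iff, Sparse.matProp_iff, check_repCov, check_repCov] at this
  exact Bool.eq_iff_iff.2 this

open Filter Topology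

/-- The standard representatives of the nilpotent orbits. -/
def rep (j : Fin 30) : Tensor := ind (wordSet (repCode j))

theorem rep_ne_zero (j : Fin 30) : rep j ≠ 0 := by
  have h : ∀ j, 0 ∈ repCode j := by decide
  intro h0
  refine (ind_ne_zero_iff (wordSet (repCode j)) (word 0)).2 ?_ (congrFun h0 (word 0))
  exact mem_wordSet.2 ⟨0, h j, rfl⟩

theorem zero_mem_closure_rep (j : Fin 30) : 0 ∈ closure {S | Rel (rep j) S} := by
  have hlim : Tendsto (fun n : ℕ => (1 / ((n : ℂ) + 1)) • rep j) atTop (𝓝 ((0 : ℂ) • rep j)) :=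
    (tendsto_one_div_add_atTop_nhds_zero_nat (𝕜 := ℂ)).smul_const _
  rw [zero_smul] at hlim
  refine mem_closure_of_tendsto hlim (Eventually.of_forall fun n => Rel.symm ?_)
  refine good_rep j _ fun w => ?_
  rw [← ind_ne_zero_iff (wordSet (repCode j)) w, Pi.smul_apply, smul_ne_zero_iff]
  exact and_iff_right (one_div_ne_zero (Nat.cast_add_one_ne_zero n))

/-- The tensor attached to a hypermatrix. -/
def uncurry : V ≃ₜ Tensor where
  toFun T w := T (w 0) (w 1) (w 2) (w 3)
  invFun S a b c d := S ![a, b, c, d]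
  left_inv _ := rfl
  right_inv S := by
    funext w
    obtain ⟨a, b, c, d, rfl⟩ := exists_word w
    rfl
  continuous_toFun := by fun_prop
  continuous_invFun := by fun_prop

theorem uncurry_zero : uncurry 0 = 0 := rfl

theorem uncurry_actG (g : G) (T : V) :
    uncurry (actG g T) = act (fun s => (![g.1, g.2.1, g.2.2.1, g.2.2.2] s).1) (uncurry T) := by
  funext w
  simp only [act, sum_word, Fin.prod_univ_four]
  rfl

theorem mem_orbitG_iff {T S : V} : S ∈ orbitG T ↔ Rel (uncurry T) (uncurry S) := by
  constructor
  · rintro ⟨g, rfl⟩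
    exact ⟨_, (uncurry_actG g T).symm⟩
  · rintro ⟨g, hg⟩
    refine ⟨(g 0, g 1, g 2, g 3), uncurry.injective ?_⟩
    rw [uncurry_actG, ← hg]
    congr 1
    funext s
    fin_cases s <;> rfl

theorem orbitG_eq_iff {T S : V} : orbitG T = orbitG S ↔ Rel (uncurry T) (uncurry S) := by
  constructor
  · intro h
    rw [← mem_orbitG_iff, h, mem_orbitG_iff]
    exact Rel.refl _
  · intro h
    ext R
    rw [mem_orbitG_iff, mem_orbitG_iff]
    exact ⟨h.symm.trans, h.trans⟩

theorem zero_mem_closure_orbitG_iff {T : V} :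
    0 ∈ closure (orbitG T) ↔ 0 ∈ closure {S | Rel (uncurry T) S} := by
  have h : orbitG T = uncurry ⁻¹' {S | Rel (uncurry T) S} := by
    ext S
    exact mem_orbitG_iff
  rw [h, ← uncurry.preimage_closure, Set.mem_preimage, uncurry_zero]

end Hypermatrix

open Hypermatrix

/-- The set of nonzero nilpotent hypermatrices (nonzero `T` with `0` in the closure of the
`G`-orbit of `T`) is a union of `G`-orbits, and it decomposes into exactly 145 distinct
`G`-orbits. -/
theorem nilpotent_orbits_complex :
    (∀ T : V, (T ≠ 0 ∧ (0 : V) ∈ closure (orbitG T)) → ∀ g : G,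
      (actG g T ≠ 0 ∧ (0 : V) ∈ closure (orbitG (actG g T)))) ∧
    Set.ncard {O : Set V | ∃ T : V, T ≠ 0 ∧ (0 : V) ∈ closure (orbitG T) ∧ O = orbitG T}
      = 30 := by
  have hne : ∀ {T : V}, T ≠ 0 ↔ uncurry T ≠ 0 := fun {T} =>
    (uncurry.injective.ne_iff' uncurry_zero).symm
  constructor
  · rintro T ⟨hT, hcl⟩ g
    have h : Rel (uncurry T) (uncurry (actG g T)) := mem_orbitG_iff.1 ⟨g, rfl⟩
    exact ⟨hne.2 (h.ne_zero (hne.1 hT)), orbitG_eq_iff.2 h ▸ hcl⟩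
  · have hrange : {O : Set V | ∃ T : V, T ≠ 0 ∧ (0 : V) ∈ closure (orbitG T) ∧ O = orbitG T} =
        Set.range fun j => orbitG (uncurry.symm (rep j)) := by
      ext O
      constructor
      · rintro ⟨T, hT, hcl, rfl⟩
        obtain ⟨j, hj⟩ := (standard_of_mem_closure
          (zero_mem_closure_orbitG_iff.1 hcl)).exists_rel_rep (hne.1 hT)
        refine ⟨j, (orbitG_eq_iff.2 ?_).symm⟩
        rwa [uncurry.apply_symm_apply]
      · rintro ⟨j, rfl⟩
        refine ⟨_, hne.2 ?_, zero_mem_closure_orbitG_iff.2 ?_, rfl⟩ <;>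
          rw [uncurry.apply_symm_apply]
        exacts [rep_ne_zero j, zero_mem_closure_rep j]
    have hinj : Function.Injective fun j => orbitG (uncurry.symm (rep j)) := by
      intro j j' h
      have := orbitG_eq_iff.1 h
      rw [uncurry.apply_symm_apply, uncurry.apply_symm_apply] at this
      exact eq_of_rel_rep this
    rw [hrange, ← Set.image_univ, Set.ncard_image_of_injective _ hinj, Set.ncard_univ,
      Nat.card_fin]
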